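/- For admissible indices 𝐤 and 𝐥 (last entry ≥ 2), the product of multiple zeta values satisfies the finite stuffle decomposition: ζ(𝐤)·ζ(𝐥) = Z(e_𝐤 * e_𝐥), obtained as the limit N → ∞ of Z_N(e_𝐤)·Z_N(e_𝐥) = Z_N(e_𝐤 * e_𝐥). -/

import Mathlib

open Finset

open scoped Classical

/-- Auxiliary front-recursion for the harmonic (stuffle) product on reversed words. -/
noncomputable def stR : List ℕ → List ℕ → (List ℕ →₀ ℚ)
  | [], w => Finsupp.single w 1
  | a :: w, [] => Finsupp.single (a :: w) 1
  | a :: w, b :: w' =>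
      (stR w (b :: w')).mapDomain (List.cons a)
    + (stR (a :: w) w').mapDomain (List.cons b)
    + (stR w w').mapDomain (List.cons (a + b))
termination_by w w' => w.length + w'.length
decreasing_by all_goals (simp; try omega)

/-- The harmonic product `e_𝐤 * e_𝐥` of two words of `𝔥¹`, encoded by their indices:
it satisfies `w e_{k₁} * w' e_{k₂} = (w * w' e_{k₂}) e_{k₁} + (w e_{k₁} * w') e_{k₂}
+ (w * w') e_{k₁+k₂}` and `w * 1 = 1 * w = w`. -/
noncomputable def harmW (w w' : List ℕ) : List ℕ →₀ ℚ :=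
  (stR w.reverse w'.reverse).mapDomain List.reverse

/-- ℚ-bilinear extension of the harmonic product to `𝔥¹`. -/
noncomputable def harmLin (f g : List ℕ →₀ ℚ) : List ℕ →₀ ℚ :=
  f.sum fun w q => g.sum fun w' q' => (q * q') • harmW w w'

/-- Auxiliary front-recursion for the shuffle product on reversed words over `{e₀,e₁}`. -/
noncomputable def shR : List Bool → List Bool → (List Bool →₀ ℚ)
  | [], w => Finsupp.single w 1
  | a :: w, [] => Finsupp.single (a :: w) 1
  | a :: w, b :: w' =>
      (shR w (b :: w')).mapDomain (List.cons a)
    + (shR (a :: w) w').mapDomain (List.cons b)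
termination_by w w' => w.length + w'.length
decreasing_by all_goals (simp; try omega)

/-- The shuffle product of two words over `{e₀,e₁}` (`true` = `e₁`): it satisfies
`w u₁ ⧢ w' u₂ = (w ⧢ w' u₂) u₁ + (w u₁ ⧢ w') u₂` and `w ⧢ 1 = 1 ⧢ w = w`. -/
noncomputable def shW (w w' : List Bool) : List Bool →₀ ℚ :=
  (shR w.reverse w'.reverse).mapDomain List.reverse

/-- The word `e_𝐤 ∈ {e₀,e₁}^*` attached to an index `𝐤` (`true` = `e₁`). -/
def wordOf (k : List ℕ) : List Bool :=
  k.flatMap (fun j => true :: List.replicate (j - 1) false)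

/-- Decode a word of `𝔥¹` back into its index. -/
def decode (w : List Bool) : List ℕ :=
  (w.foldr (fun b p => if b then (0, (p.1 + 1) :: p.2) else (p.1 + 1, p.2))
    ((0, []) : ℕ × List ℕ)).2

/-- The shuffle product on `𝔥¹`, expressed in the index encoding, extended ℚ-bilinearly. -/
noncomputable def shIdxLin (f g : List ℕ →₀ ℚ) : List ℕ →₀ ℚ :=
  f.sum fun w q => g.sum fun w' q' =>
    (q * q') • ((shW (wordOf w) (wordOf w')).mapDomain decode)

/-- The multiple harmonic sum `ζ_{<N}(𝐤)`. -/
noncomputable def MHS (N : ℕ) (k : List ℕ) : ℝ :=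
  ∑ n ∈ Finset.univ.filter
      (fun n : Fin k.length → Fin N => (∀ i, 0 < (n i : ℕ)) ∧ StrictMono n),
    ∏ i, (1 : ℝ) / (n i : ℕ) ^ k.get i

/-- `Z_N : 𝔥¹ → ℝ`, the ℚ-linear map with `Z_N(e_𝐤) = ζ_{<N}(𝐤)`, `Z_N(1) = 1`. -/
noncomputable def ZN (N : ℕ) (f : List ℕ →₀ ℚ) : ℝ :=
  f.sum fun k q => (q : ℝ) * MHS N k

/-- `f ∈ 𝔥¹`: every word in the support is an index (all entries positive). -/
def MemH1 (f : List ℕ →₀ ℚ) : Prop := ∀ w ∈ f.support, ∀ x ∈ w, 0 < x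

/-- `f ∈ 𝔥⁰`: every word in the support is an admissible index. -/
def MemH0 (f : List ℕ →₀ ℚ) : Prop :=
  ∀ w ∈ f.support, (∀ x ∈ w, 0 < x) ∧ ∀ x, w.getLast? = some x → 2 ≤ x

/-- The multiple zeta value `ζ(𝐤)` as an infinite sum over strictly increasing tuples. -/
noncomputable def zetaIdx (k : List ℕ) : ℝ :=
  ∑' n : {n : Fin k.length → ℕ // (∀ i, 0 < n i) ∧ StrictMono n},
    ∏ i, (1 : ℝ) / (n.1 i : ℝ) ^ k.get i

/-- `Z : 𝔥⁰ → ℝ`, the ℚ-linear MZV evaluation map. -/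
noncomputable def ZReal (f : List ℕ →₀ ℚ) : ℝ :=
  f.sum fun k q => (q : ℝ) * zetaIdx k


/-- linear evaluation -/
noncomputable def evL (φ : List ℕ → ℝ) (f : List ℕ →₀ ℚ) : ℝ := f.sum fun k q => (q : ℝ) * φ k

lemma evL_single (φ : List ℕ → ℝ) (w : List ℕ) : evL φ (Finsupp.single w 1) = φ w := by
  unfold evL
  rw [Finsupp.sum_single_index] <;> simp

lemma evL_add (φ : List ℕ → ℝ) (f g : List ℕ →₀ ℚ) : evL φ (f + g) = evL φ f + evL φ g := by
  unfold evL
  rw [Finsupp.sum_add_index'] <;> intros <;> push_cast <;> ring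

lemma evL_map (φ : List ℕ → ℝ) (g : List ℕ → List ℕ) (f : List ℕ →₀ ℚ) :
    evL φ (f.mapDomain g) = evL (fun w => φ (g w)) f := by
  unfold evL
  rw [Finsupp.sum_mapDomain_index] <;> intros <;> push_cast <;> ring

lemma evL_fadd (φ ψ : List ℕ → ℝ) (c : ℝ) (f : List ℕ →₀ ℚ) :
    evL (fun w => φ w + c * ψ w) f = evL φ f + c * evL ψ f := by
  unfold evL
  simp only [Finsupp.sum, Finset.mul_sum, ← Finset.sum_add_distrib]
  refine Finset.sum_congr rfl fun _ _ => by ring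

/-- nested harmonic sums on reversed words -/
noncomputable def HR : List ℕ → ℕ → ℝ
  | [], _ => 1
  | a :: w, N => ∑ m ∈ Finset.Ico 1 N, (1 : ℝ) / (m : ℝ) ^ a * HR w m

lemma HR_zero (a : ℕ) (w : List ℕ) : HR (a :: w) 0 = 0 := by simp [HR]

lemma HR_one (a : ℕ) (w : List ℕ) : HR (a :: w) 1 = 0 := by simp [HR]

lemma HR_succ (a : ℕ) (w : List ℕ) (N : ℕ) (hN : 1 ≤ N) :
    HR (a :: w) (N + 1) = HR (a :: w) N + (1 : ℝ) / (N : ℝ) ^ a * HR w N := by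
  simp only [HR]
  rw [Finset.sum_Ico_succ_top hN]

lemma evL_zero (f : List ℕ →₀ ℚ) : evL (fun _ => 0) f = 0 := by
  simp [evL]

lemma HR_stuffle (u v : List ℕ) : ∀ N, HR u N * HR v N = evL (fun w => HR w N) (stR u v) := by
  induction u, v using stR.induct with
  | case1 w => intro N; rw [stR, evL_single]; simp [HR]
  | case2 a w => intro N; rw [stR, evL_single]; simp [HR]
  | case3 a w b w' ih1 ih2 ih3 =>
    intro N
    rw [stR]
    simp only [evL_add, evL_map]
    induction N with
    | zero => simp only [HR_zero, evL_zero]; simp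
    | succ N ih =>
      rcases Nat.eq_zero_or_pos N with rfl | hN
      · simp only [zero_add, HR_one, evL_zero]; simp
      · simp only [HR_succ _ _ N hN, evL_fadd]
        rw [← ih1 N, ← ih2 N, ← ih3 N, pow_add]
        have hN' : (N : ℝ) ≠ 0 := by positivity
        have e : (1 : ℝ) / ((N : ℝ) ^ a * (N : ℝ) ^ b) = 1 / (N : ℝ) ^ a * (1 / (N : ℝ) ^ b) := by
          field_simp
        rw [e]
        linear_combination ih

/-- index set -/
noncomputable def SS (N r : ℕ) : Finset (Fin r → ℕ) :=
  (Fintype.piFinset fun _ => Finset.range N).filter (fun n => (∀ i, 0 < n i) ∧ StrictMono n)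

lemma mem_SS {N r : ℕ} {n : Fin r → ℕ} :
    n ∈ SS N r ↔ (∀ i, n i < N) ∧ (∀ i, 0 < n i) ∧ StrictMono n := by
  simp [SS]

/-- nested sums with function index -/
noncomputable def GG (N r : ℕ) (κ : Fin r → ℕ) : ℝ :=
  ∑ n ∈ SS N r, ∏ i, (1 : ℝ) / (n i : ℝ) ^ κ i

lemma MHS_eq_GG (N : ℕ) (k : List ℕ) : MHS N k = GG N k.length k.get := by
  unfold MHS GG
  refine Finset.sum_bij (fun n _ i => (n i : ℕ)) ?_ ?_ ?_ ?_
  · intro n hn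
    rw [Finset.mem_filter] at hn
    exact mem_SS.2 ⟨fun i => (n i).2, hn.2.1, fun i j h => hn.2.2 h⟩
  · intro n _ n' _ h
    funext i
    exact Fin.ext (congrFun h i)
  · intro n hn
    rw [mem_SS] at hn
    exact ⟨fun i => ⟨n i, hn.1 i⟩, by
      simp only [Finset.mem_filter, Finset.mem_univ, true_and]
      exact ⟨hn.2.1, fun i j h => hn.2.2 h⟩, rfl⟩
  · intro n _
    rfl

lemma GG_cast (N r r' : ℕ) (h : r = r') (κ : Fin r → ℕ) (κ' : Fin r' → ℕ)
    (hκ : ∀ i, κ i = κ' (Fin.cast h i)) : GG N r κ = GG N r' κ' := by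
  subst h
  have : κ = κ' := funext hκ
  rw [this]

lemma snoc_mem {N r m : ℕ} {n : Fin r → ℕ} (hm : m ∈ Finset.Ico 1 N) (hn : n ∈ SS m r) :
    (Fin.snoc n m : Fin (r + 1) → ℕ) ∈ SS N (r + 1) := by
  rw [Finset.mem_Ico] at hm
  rw [mem_SS] at hn ⊢
  refine ⟨fun i => ?_, fun i => ?_, fun i j => ?_⟩
  · refine Fin.lastCases ?_ (fun i => ?_) i
    · simpa using hm.2
    · simpa using (hn.1 i).trans hm.2
  · refine Fin.lastCases ?_ (fun i => ?_) i
    · rw [Fin.snoc_last]; exact hm.1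
    · simpa using hn.2.1 i
  · refine Fin.lastCases ?_ (fun i => ?_) i
    · intro h
      exact absurd (Fin.le_last j) (not_le.2 h)
    · refine Fin.lastCases ?_ (fun j => ?_) j
      · intro _
        simpa using hn.1 i
      · intro h
        simpa using hn.2.2 (Fin.castSucc_lt_castSucc_iff.1 h)

lemma GG_snoc (N r : ℕ) (κ : Fin (r + 1) → ℕ) :
    GG N (r + 1) κ = ∑ m ∈ Finset.Ico 1 N,
      (1 : ℝ) / (m : ℝ) ^ κ (Fin.last r) * GG m r (fun i => κ i.castSucc) := by
  unfold GG
  simp only [Finset.mul_sum]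
  rw [Finset.sum_sigma']
  symm
  refine Finset.sum_bij (fun (x : (_ : ℕ) × (Fin r → ℕ)) _ => (Fin.snoc x.2 x.1 : Fin (r + 1) → ℕ))
    ?_ ?_ ?_ ?_
  · rintro ⟨m, n⟩ h
    rw [Finset.mem_sigma] at h
    exact snoc_mem h.1 h.2
  · rintro ⟨m, n⟩ _ ⟨m', n'⟩ _ h
    have h1 := congrFun h (Fin.last r)
    have h2 : n = n' := funext fun i => by simpa using congrFun h i.castSucc
    simp only [Fin.snoc_last] at h1
    subst h1 h2
    rfl
  · intro n hn
    rw [mem_SS] at hn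
    refine ⟨⟨n (Fin.last r), fun i => n i.castSucc⟩, ?_, ?_⟩
    · rw [Finset.mem_sigma, Finset.mem_Ico, mem_SS]
      exact ⟨⟨hn.2.1 _, hn.1 _⟩, fun i => hn.2.2 (Fin.castSucc_lt_last i), fun i => hn.2.1 _,
        fun i j h => hn.2.2 (Fin.castSucc_lt_castSucc_iff.2 h)⟩
    · funext i
      refine Fin.lastCases ?_ (fun i => ?_) i <;> simp
  · rintro ⟨m, n⟩ _
    rw [Fin.prod_univ_castSucc]
    simp only [Fin.snoc_last, Fin.snoc_castSucc]
    rw [mul_comm]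

lemma MHS_eq_HR (k : List ℕ) : ∀ N, MHS N k = HR k.reverse N := by
  induction k using List.reverseRecOn with
  | nil =>
    intro N
    rw [MHS_eq_GG]
    have : SS N 0 = Finset.univ := by
      ext n
      simp only [mem_SS, Finset.mem_univ, iff_true]
      exact ⟨fun i => i.elim0, fun i => i.elim0, fun i => i.elim0⟩
    simp [GG, HR, this]
  | append_singleton k a ih =>
    intro N
    rw [MHS_eq_GG, List.reverse_append, List.reverse_singleton, List.singleton_append, HR,
      GG_cast N _ (k.length + 1) (by simp) _ (Fin.snoc k.get a), GG_snoc]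
    · refine Finset.sum_congr rfl fun m _ => ?_
      rw [← ih m, MHS_eq_GG]
      simp only [Fin.snoc_last, Fin.snoc_castSucc]
    · rintro ⟨i, hi⟩
      simp only [List.length_append, List.length_singleton] at hi
      rcases Nat.lt_succ_iff_lt_or_eq.1 hi with h | h
      · have : Fin.cast (by simp) (⟨i, by simpa using hi⟩ : Fin (k ++ [a]).length)
            = (Fin.castSucc ⟨i, h⟩ : Fin (k.length + 1)) := rfl
        rw [this, Fin.snoc_castSucc]
        simp [List.getElem_append_left, h]
      · subst h
        have : Fin.cast (by simp) (⟨k.length, by simp⟩ : Fin (k ++ [a]).length)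
            = (Fin.last k.length : Fin (k.length + 1)) := rfl
        rw [this, Fin.snoc_last]
        simp

lemma term_bound {r : ℕ} (κ : Fin (r + 1) → ℕ) (h1 : ∀ i, 0 < κ i) (h2 : 2 ≤ κ (Fin.last r))
    (n : Fin (r + 1) → ℕ) (hn : ∀ i, 0 < n i) (hm : StrictMono n) :
    ∏ i, (1 : ℝ) / (n i : ℝ) ^ κ i ≤
      ∏ i, (1 : ℝ) / (n i : ℝ) ^ (1 + 1 / ((r : ℝ) + 1)) := by
  have hp : ∀ i, (0 : ℝ) < n i := fun i => by exact_mod_cast hn i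
  have hp1 : ∀ i, (1 : ℝ) ≤ n i := fun i => by exact_mod_cast hn i
  simp only [one_div, Finset.prod_inv_distrib]
  refine inv_anti₀ (Finset.prod_pos fun i _ => Real.rpow_pos_of_pos (hp i) _) ?_
  have e1 : ∏ i, (n i : ℝ) ^ (1 + ((r : ℝ) + 1)⁻¹) =
      (∏ i, (n i : ℝ)) * ∏ i, (n i : ℝ) ^ (((r : ℝ) + 1)⁻¹) := by
    rw [← Finset.prod_mul_distrib]
    refine Finset.prod_congr rfl fun i _ => ?_
    rw [Real.rpow_add (hp i), Real.rpow_one]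
  have e2 : ∏ i, (n i : ℝ) ^ (((r : ℝ) + 1)⁻¹) ≤ n (Fin.last r) := by
    calc ∏ i, (n i : ℝ) ^ (((r : ℝ) + 1)⁻¹)
        ≤ ∏ i : Fin (r + 1), (n (Fin.last r) : ℝ) ^ (((r : ℝ) + 1)⁻¹) := by
          refine Finset.prod_le_prod (fun i _ => (Real.rpow_pos_of_pos (hp i) _).le) fun i _ => ?_
          refine Real.rpow_le_rpow (hp i).le ?_ (by positivity)
          exact_mod_cast hm.monotone (Fin.le_last i)
      _ = n (Fin.last r) := by
          rw [Finset.prod_const, Finset.card_univ, Fintype.card_fin, ← Real.rpow_natCast,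
            ← Real.rpow_mul (hp _).le]
          push_cast
          rw [inv_mul_cancel₀ (by positivity), Real.rpow_one]
  rw [e1]
  refine (mul_le_mul_of_nonneg_left e2 (Finset.prod_nonneg fun i _ => (hp i).le)).trans ?_
  rw [Fin.prod_univ_castSucc, Fin.prod_univ_castSucc, mul_assoc]
  refine mul_le_mul ?_ ?_ (mul_nonneg (hp _).le (hp _).le)
    (Finset.prod_nonneg fun i _ => pow_nonneg (hp _).le _)
  · refine Finset.prod_le_prod (fun i _ => (hp _).le) fun i _ => ?_
    exact le_self_pow₀ (hp1 _) (h1 _).ne'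
  · rw [← sq]
    exact pow_le_pow_right₀ (hp1 _) h2

lemma summ_aux {r : ℕ} (κ : Fin (r + 1) → ℕ) (h1 : ∀ i, 0 < κ i) (h2 : 2 ≤ κ (Fin.last r)) :
    Summable (fun n : {n : Fin (r + 1) → ℕ // (∀ i, 0 < n i) ∧ StrictMono n} =>
      ∏ i, (1 : ℝ) / (n.1 i : ℝ) ^ κ i) := by
  have hs : Summable (fun m : ℕ => (1 : ℝ) / (m : ℝ) ^ (1 + 1 / ((r : ℝ) + 1))) :=
    Real.summable_one_div_nat_rpow.2 (by
      have : (0 : ℝ) < 1 / ((r : ℝ) + 1) := by positivity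
      linarith)
  refine summable_of_sum_le (c := ∏ _i : Fin (r + 1),
    ∑' m : ℕ, (1 : ℝ) / (m : ℝ) ^ (1 + 1 / ((r : ℝ) + 1))) ?_ ?_
  · intro n
    exact Finset.prod_nonneg fun i _ => by positivity
  · intro u
    obtain ⟨M, hM⟩ : ∃ M, ∀ n ∈ u, ∀ i, n.1 i < M := by
      refine ⟨u.sup (fun n => n.1 (Fin.last r)) + 1, fun n hn i => Nat.lt_succ_of_le ?_⟩
      exact (n.2.2.monotone (Fin.le_last i)).trans
        (Finset.le_sup (f := fun n : {n : Fin (r + 1) → ℕ // (∀ i, 0 < n i) ∧ StrictMono n} =>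
          n.1 (Fin.last r)) hn)
    calc ∑ n ∈ u, ∏ i, (1 : ℝ) / (n.1 i : ℝ) ^ κ i
        ≤ ∑ n ∈ u, ∏ i, (1 : ℝ) / (n.1 i : ℝ) ^ (1 + 1 / ((r : ℝ) + 1)) :=
          Finset.sum_le_sum fun n _ => term_bound κ h1 h2 n.1 n.2.1 n.2.2
      _ = ∑ n ∈ u.map (Function.Embedding.subtype _),
            ∏ i, (1 : ℝ) / (n i : ℝ) ^ (1 + 1 / ((r : ℝ) + 1)) := by
          rw [Finset.sum_map]; rfl
      _ ≤ ∑ n ∈ Fintype.piFinset (fun _ : Fin (r + 1) => Finset.range M),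
            ∏ i, (1 : ℝ) / (n i : ℝ) ^ (1 + 1 / ((r : ℝ) + 1)) := by
          refine Finset.sum_le_sum_of_subset_of_nonneg ?_ ?_
          · intro n hn
            rw [Finset.mem_map] at hn
            obtain ⟨n, hn, rfl⟩ := hn
            rw [Fintype.mem_piFinset]
            intro i
            exact Finset.mem_range.2 (hM n hn i)
          · intro n _ _
            exact Finset.prod_nonneg fun i _ => by positivity
      _ = ∏ _i : Fin (r + 1), ∑ m ∈ Finset.range M,
            (1 : ℝ) / (m : ℝ) ^ (1 + 1 / ((r : ℝ) + 1)) := by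
          rw [Finset.prod_univ_sum]
      _ ≤ _ := by
          refine Finset.prod_le_prod (fun i _ => Finset.sum_nonneg fun m _ => by positivity)
            fun i _ => ?_
          exact hs.sum_le_tsum _ fun m _ => by positivity

lemma summ_list (k : List ℕ) (hk : (∀ x ∈ k, 0 < x) ∧ ∀ x, k.getLast? = some x → 2 ≤ x) :
    Summable (fun n : {n : Fin k.length → ℕ // (∀ i, 0 < n i) ∧ StrictMono n} =>
      ∏ i, (1 : ℝ) / (n.1 i : ℝ) ^ k.get i) := by
  have key : ∀ (r : ℕ) (κ : Fin r → ℕ), (∀ i, 0 < κ i) → (∀ i : Fin r, i.1 + 1 = r → 2 ≤ κ i) →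
      Summable (fun n : {n : Fin r → ℕ // (∀ i, 0 < n i) ∧ StrictMono n} =>
        ∏ i, (1 : ℝ) / (n.1 i : ℝ) ^ κ i) := by
    intro r κ h1 h2
    cases r with
    | zero => exact Summable.of_finite
    | succ r => exact summ_aux κ h1 (h2 _ rfl)
  refine key _ _ (fun i => hk.1 _ (List.get_mem k i)) fun i hi => hk.2 _ ?_
  rw [List.getLast?_eq_getElem?]
  have : k.length - 1 = i.1 := by omega
  rw [this]
  simp

lemma MHS_tendsto (k : List ℕ) (hk : (∀ x ∈ k, 0 < x) ∧ ∀ x, k.getLast? = some x → 2 ≤ x) :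
    Filter.Tendsto (fun N => MHS N k) Filter.atTop (nhds (zetaIdx k)) := by
  have h := (summ_list k hk).hasSum
  have ht : Filter.Tendsto (fun N : ℕ =>
      (Fintype.piFinset fun _ : Fin k.length => Finset.range N).subtype
        (fun n => (∀ i, 0 < n i) ∧ StrictMono n)) Filter.atTop Filter.atTop := by
    refine Filter.tendsto_atTop_finset_of_monotone ?_ ?_
    · intro N M hNM n hn
      simp only [Finset.mem_subtype, Fintype.mem_piFinset, Finset.mem_range] at hn ⊢
      exact fun i => (hn i).trans_le hNM
    · intro n
      refine ⟨Finset.univ.sup n.1 + 1, ?_⟩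
      simp only [Finset.mem_subtype, Fintype.mem_piFinset, Finset.mem_range]
      exact fun i => Nat.lt_succ_of_le (Finset.le_sup (f := n.1) (Finset.mem_univ i))
  refine (h.comp ht).congr fun N => ?_
  rw [MHS_eq_GG]
  unfold GG SS
  exact Finset.sum_subtype_eq_sum_filter (fun n : Fin k.length → ℕ =>
    ∏ i, (1 : ℝ) / (n i : ℝ) ^ k.get i)

/-- admissibility of reversed words -/
def AdmR (w : List ℕ) : Prop := (∀ x ∈ w, 0 < x) ∧ ∀ x, w.head? = some x → 2 ≤ x

lemma stR_pos (u v : List ℕ) : (∀ x ∈ u, 0 < x) → (∀ x ∈ v, 0 < x) →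
    ∀ w ∈ (stR u v).support, ∀ x ∈ w, 0 < x := by
  induction u, v using stR.induct with
  | case1 w =>
    intro hu hv z hz
    rw [stR] at hz
    have := Finsupp.support_single_subset hz
    rw [Finset.mem_singleton] at this
    subst this; exact hv
  | case2 a w =>
    intro hu hv z hz
    rw [stR] at hz
    have := Finsupp.support_single_subset hz
    rw [Finset.mem_singleton] at this
    subst this; exact hu
  | case3 a w b w' ih1 ih2 ih3 =>
    intro hu hv z hz
    rw [stR] at hz
    have hu' := List.forall_mem_cons.1 hu
    have hv' := List.forall_mem_cons.1 hv
    rcases Finset.mem_union.1 (Finsupp.support_add hz) with hz | hz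
    · rcases Finset.mem_union.1 (Finsupp.support_add hz) with hz | hz
      · obtain ⟨y, hy, rfl⟩ := Finset.mem_image.1 (Finsupp.mapDomain_support hz)
        exact List.forall_mem_cons.2 ⟨hu'.1, ih1 hu'.2 hv y hy⟩
      · obtain ⟨y, hy, rfl⟩ := Finset.mem_image.1 (Finsupp.mapDomain_support hz)
        exact List.forall_mem_cons.2 ⟨hv'.1, ih2 hu hv'.2 y hy⟩
    · obtain ⟨y, hy, rfl⟩ := Finset.mem_image.1 (Finsupp.mapDomain_support hz)
      exact List.forall_mem_cons.2 ⟨by have := hu'.1; omega, ih3 hu'.2 hv'.2 y hy⟩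

lemma stR_adm (u v : List ℕ) (hu : AdmR u) (hv : AdmR v) : ∀ w ∈ (stR u v).support, AdmR w := by
  intro z hz
  refine ⟨stR_pos u v hu.1 hv.1 z hz, ?_⟩
  cases u with
  | nil =>
    rw [stR] at hz
    have := Finsupp.support_single_subset hz
    rw [Finset.mem_singleton] at this
    subst this; exact hv.2
  | cons a w =>
    have ha : 2 ≤ a := hu.2 a rfl
    cases v with
    | nil =>
      rw [stR] at hz
      have := Finsupp.support_single_subset hz
      rw [Finset.mem_singleton] at this
      subst this; exact hu.2
    | cons b w' =>
      have hb : 2 ≤ b := hv.2 b rfl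
      rw [stR] at hz
      rcases Finset.mem_union.1 (Finsupp.support_add hz) with hz | hz
      · rcases Finset.mem_union.1 (Finsupp.support_add hz) with hz | hz
        · obtain ⟨y, hy, rfl⟩ := Finset.mem_image.1 (Finsupp.mapDomain_support hz)
          simpa using ha
        · obtain ⟨y, hy, rfl⟩ := Finset.mem_image.1 (Finsupp.mapDomain_support hz)
          simpa using hb
      · obtain ⟨y, hy, rfl⟩ := Finset.mem_image.1 (Finsupp.mapDomain_support hz)
        simp only [List.head?_cons, Option.some.injEq, forall_eq']
        omega

lemma harmW_adm (K L : List ℕ)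
    (hK : (∀ x ∈ K, 0 < x) ∧ ∀ x, K.getLast? = some x → 2 ≤ x)
    (hL : (∀ x ∈ L, 0 < x) ∧ ∀ x, L.getLast? = some x → 2 ≤ x) : MemH0 (harmW K L) := by
  intro w hw
  obtain ⟨y, hy, rfl⟩ := Finset.mem_image.1 (Finsupp.mapDomain_support hw)
  have := stR_adm K.reverse L.reverse (by simpa [AdmR] using hK) (by simpa [AdmR] using hL) y hy
  simpa [AdmR] using this

/-- for admissible indices `𝐤, 𝐥`, one has the finite stuffle
decomposition `ζ(𝐤)·ζ(𝐥) = Z(e_𝐤 * e_𝐥)`, obtained as the limit `N → ∞` of the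
identity `Z_N(e_𝐤)·Z_N(e_𝐥) = Z_N(e_𝐤 * e_𝐥)`. -/
theorem stmt_13 (K L : List ℕ)
    (hK : (∀ x ∈ K, 0 < x) ∧ ∀ x, K.getLast? = some x → 2 ≤ x)
    (hL : (∀ x ∈ L, 0 < x) ∧ ∀ x, L.getLast? = some x → 2 ≤ x) :
    zetaIdx K * zetaIdx L = ZReal (harmW K L) ∧
    (∀ N : ℕ, MHS N K * MHS N L = ZN N (harmW K L)) ∧
    Filter.Tendsto (fun N : ℕ => ZN N (harmW K L)) Filter.atTop
      (nhds (ZReal (harmW K L))) := by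
  have h2 : ∀ N : ℕ, MHS N K * MHS N L = ZN N (harmW K L) := by
    intro N
    rw [MHS_eq_HR, MHS_eq_HR, HR_stuffle]
    change _ = evL (fun w => MHS N w) (harmW K L)
    unfold harmW
    rw [evL_map]
    simp only [MHS_eq_HR, List.reverse_reverse]
  have h3 : Filter.Tendsto (fun N : ℕ => ZN N (harmW K L)) Filter.atTop
      (nhds (ZReal (harmW K L))) := by
    unfold ZN ZReal Finsupp.sum
    exact tendsto_finsetSum _ fun w hw =>
      (MHS_tendsto w (harmW_adm K L hK hL w hw)).const_mul _
  refine ⟨?_, h2, h3⟩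
  refine tendsto_nhds_unique ?_ h3
  simp only [← h2]
  exact (MHS_tendsto K hK).mul (MHS_tendsto L hL)
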